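/- Let Σ be a real positive definite p×p matrix with modified Cholesky decomposition Σ = L D Lᵀ, where L is lower triangular with unit diagonal and D is diagonal, and let k ≥ 0 be an integer. Then Σ is k-banded (σ_{ij} = 0 whenever |i−j| > k) if and only if L is k-banded (l_{ij} = 0 whenever |i−j| > k). -/

import Mathlib

open Matrix

/-- For a positive definite `Σ = L D Lᵀ` (modified Cholesky decomposition)
and any integer `k ≥ 0`, `Σ` is `k`-banded iff its Cholesky factor `L` is `k`-banded. -/
theorem cholesky_banded_iff
    (p : ℕ) (S L D : Matrix (Fin p) (Fin p) ℝ) (k : ℕ)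
    (hS : S.PosDef)
    (hL_lower : ∀ i j : Fin p, i < j → L i j = 0)
    (hL_diag : ∀ i : Fin p, L i i = 1)
    (hD_diag : ∀ i j : Fin p, i ≠ j → D i j = 0)
    (hdecomp : S = L * D * Lᵀ) :
    (∀ i j : Fin p, (k : ℤ) < |((i : ℕ) : ℤ) - ((j : ℕ) : ℤ)| → S i j = 0) ↔
      (∀ i j : Fin p, (k : ℤ) < |((i : ℕ) : ℤ) - ((j : ℕ) : ℤ)| → L i j = 0) := by
  have hD : D = Matrix.diagonal (fun i => D i i) := by
    ext i j
    by_cases h : i = j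
    · subst h; simp
    · rw [hD_diag i j h, Matrix.diagonal_apply_ne _ h]
  have hdet : S.det ≠ 0 := hS.det_pos.ne'
  have hDne : ∀ j, D j j ≠ 0 := by
    intro j hj
    apply hdet
    have h0 : D.det = 0 := by
      rw [hD, Matrix.det_diagonal]
      exact Finset.prod_eq_zero (Finset.mem_univ j) hj
    rw [hdecomp, Matrix.det_mul, Matrix.det_mul, h0]
    simp
  have hSij : ∀ i j, S i j = ∑ m, L i m * D m m * L j m := by
    intro i j
    rw [hdecomp, hD]
    rw [Matrix.mul_apply]
    simp only [Matrix.mul_diagonal, Matrix.transpose_apply, Matrix.diagonal_apply_eq]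
  constructor
  · intro hSb
    have key : ∀ n : ℕ, ∀ i j : Fin p, (j : ℕ) = n → (j : ℕ) + k < i → L i j = 0 := by
      intro n
      induction n using Nat.strong_induction_on with
      | _ n ih =>
        intro i j hjn hij
        have h1 := hSb i j (lt_abs.2 (Or.inl (by omega)))
        rw [hSij, Finset.sum_eq_single j] at h1
        · simpa [hL_diag, hDne j] using h1
        · intro m _ hm
          rcases lt_or_gt_of_ne hm with h | h
          · have h' : (m : ℕ) < j := h
            rw [ih m (by omega) i m rfl (by omega)]
            simp
          · rw [hL_lower j m h]
            simp
        · simp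
    intro i j hij
    rcases lt_abs.1 hij with h | h
    · exact key _ i j rfl (by omega)
    · exact hL_lower i j (Fin.lt_def.2 (by omega))
  · intro hLb i j hij
    rw [hSij]
    apply Finset.sum_eq_zero
    intro m _
    rcases lt_abs.1 hij with h | h
    · rcases lt_or_ge j m with hm | hm
      · rw [hL_lower j m hm]; simp
      · have hm' : (m : ℕ) ≤ j := hm
        rw [hLb i m (lt_abs.2 (Or.inl (by omega)))]; simp
    · rcases lt_or_ge i m with hm | hm
      · rw [hL_lower i m hm]; simp
      · have hm' : (m : ℕ) ≤ i := hm
        rw [hLb j m (lt_abs.2 (Or.inl (by omega)))]; simp
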